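/- Let G be a finite k-regular simple graph with k ≥ 2, let l ≤ m be positive integers with e·k²·m·(l/m)^k ≤ 1, and let L be an assignment of a set L(v) of m colors to each vertex v. Then there exists, for each vertex v, an l-element subset L'(v) ⊆ L(v) such that for every vertex v the intersection ⋂_{u ∈ N(v)} L'(u) over the neighbors u of v is empty. -/

import Mathlib

open SimpleGraph Set

def IsDynamicColoring {V : Type*} (G : SimpleGraph V) {n : ℕ} (c : V → Fin n) : Prop :=
  (∀ ⦃u v⦄, G.Adj u v → c u ≠ c v) ∧
  ∀ v : V, 2 ≤ (G.neighborSet v).ncard →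
    ∃ u w, u ∈ G.neighborSet v ∧ w ∈ G.neighborSet v ∧ c u ≠ c w

def DynColorable {V : Type*} (G : SimpleGraph V) (n : ℕ) : Prop :=
  ∃ c : V → Fin n, IsDynamicColoring G c

noncomputable def dynChromNum {V : Type*} (G : SimpleGraph V) : ℕ :=
  sInf {n | DynColorable G n}

noncomputable def chromNum {V : Type*} (G : SimpleGraph V) : ℕ :=
  sInf {n | G.Colorable n}

/-- `G` is `k`-regular: every vertex has exactly `k` neighbors. -/
def IsKRegular {V : Type*} (G : SimpleGraph V) (k : ℕ) : Prop :=
  ∀ v : V, (G.neighborSet v).ncard = k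


open Classical in
/-- The members of `Ω₀` avoiding all the bad events `A w` with `w ∈ S`. -/
noncomputable def avoiding {V Ω : Type*} (Ω₀ : Finset Ω) (A : V → Ω → Prop) (S : Finset V) :
    Finset Ω :=
  Ω₀.filter fun ω => ∀ w ∈ S, ¬ A w ω

lemma mem_avoiding {V Ω : Type*} {Ω₀ : Finset Ω} {A : V → Ω → Prop} {S : Finset V} {ω : Ω} :
    ω ∈ avoiding Ω₀ A S ↔ ω ∈ Ω₀ ∧ ∀ w ∈ S, ¬ A w ω := by
  simp [avoiding]

lemma avoiding_anti {V Ω : Type*} (Ω₀ : Finset Ω) (A : V → Ω → Prop) {S T : Finset V}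
    (h : S ⊆ T) : avoiding Ω₀ A T ⊆ avoiding Ω₀ A S := fun _ hω =>
  mem_avoiding.2 ⟨(mem_avoiding.1 hω).1, fun w hw => (mem_avoiding.1 hω).2 w (h hw)⟩

open Classical in
lemma card_avoiding_insert {V Ω : Type*} (Ω₀ : Finset Ω) (A : V → Ω → Prop) (S : Finset V)
    (v : V) :
    ((avoiding Ω₀ A (insert v S)).card : ℝ) =
      (avoiding Ω₀ A S).card - ((avoiding Ω₀ A S).filter (A v)).card := by
  have h : avoiding Ω₀ A (insert v S) = (avoiding Ω₀ A S).filter (fun ω => ¬ A v ω) := by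
    ext ω
    simp only [mem_avoiding, Finset.mem_filter, Finset.forall_mem_insert]
    tauto
  have h' := Finset.card_filter_add_card_filter_not (s := avoiding Ω₀ A S) (A v)
  rw [h, ← h']
  push_cast
  ring

open Classical in
/-- The inductive estimate of the local lemma, for the uniform measure on a finite set. -/
lemma card_filter_avoiding_le {V Ω : Type*} (Ω₀ : Finset Ω) (A : V → Ω → Prop)
    (nbr : V → Finset V) (d : ℕ) (hd : ∀ v, (nbr v).card ≤ d) (p x : ℝ) (hx0 : 0 ≤ x)
    (hx1 : x ≤ 1) (hpx : p ≤ x * (1 - x) ^ d)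
    (hA : ∀ v (S : Finset V), v ∉ S → Disjoint S (nbr v) →
      (((avoiding Ω₀ A S).filter (A v)).card : ℝ) ≤ p * (avoiding Ω₀ A S).card)
    (S : Finset V) :
    ∀ v ∉ S, (((avoiding Ω₀ A S).filter (A v)).card : ℝ) ≤ x * (avoiding Ω₀ A S).card := by
  induction S using Finset.strongInduction with
  | H S ih =>
  intro v hv
  have hchain : ∀ T ⊆ S ∩ nbr v, (1 - x) ^ T.card * ((avoiding Ω₀ A (S \ nbr v)).card : ℝ) ≤
      (avoiding Ω₀ A ((S \ nbr v) ∪ T)).card := by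
    intro T
    induction T using Finset.induction_on with
    | empty => simp
    | insert w T hw ihT =>
      intro hT
      have hwS := Finset.mem_inter.1 (hT (Finset.mem_insert_self w T))
      have hTS : T ⊆ S ∩ nbr v := (Finset.subset_insert w T).trans hT
      have hw' : w ∉ (S \ nbr v) ∪ T := by simp [hw, hwS.2]
      have hss : (S \ nbr v) ∪ T ⊂ S := by
        refine (Finset.ssubset_iff_of_subset ?_).2 ⟨w, hwS.1, hw'⟩
        exact Finset.union_subset Finset.sdiff_subset (hTS.trans Finset.inter_subset_left)
      have h1 := ih _ hss w hw'
      have h2 := mul_le_mul_of_nonneg_left (ihT hTS) (sub_nonneg.2 hx1)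
      rw [Finset.union_insert, card_avoiding_insert, Finset.card_insert_of_notMem hw, pow_succ]
      linarith
  have hmain := hchain _ subset_rfl
  rw [Finset.sdiff_union_inter] at hmain
  have hcard : (S ∩ nbr v).card ≤ d :=
    (Finset.card_le_card Finset.inter_subset_right).trans (hd v)
  have hpow : (1 - x) ^ d ≤ (1 - x) ^ (S ∩ nbr v).card :=
    pow_le_pow_of_le_one (sub_nonneg.2 hx1) (by linarith) hcard
  calc (((avoiding Ω₀ A S).filter (A v)).card : ℝ)
      ≤ ((avoiding Ω₀ A (S \ nbr v)).filter (A v)).card := by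
        exact_mod_cast Finset.card_le_card
          (Finset.filter_subset_filter _ (avoiding_anti _ _ Finset.sdiff_subset))
    _ ≤ p * (avoiding Ω₀ A (S \ nbr v)).card :=
        hA v _ (fun h => hv (Finset.sdiff_subset h)) Finset.sdiff_disjoint
    _ ≤ x * (1 - x) ^ d * (avoiding Ω₀ A (S \ nbr v)).card := by gcongr
    _ ≤ x * ((1 - x) ^ (S ∩ nbr v).card * (avoiding Ω₀ A (S \ nbr v)).card) := by
        rw [mul_assoc]; gcongr
    _ ≤ x * (avoiding Ω₀ A S).card := by gcongr

open Classical in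
/-- Symmetric (lopsided) Lovász local lemma for the uniform measure on a finite set. -/
theorem exists_forall_not_of_local {V Ω : Type*} [Fintype V] (Ω₀ : Finset Ω)
    (hΩ : Ω₀.Nonempty) (A : V → Ω → Prop)
    (nbr : V → Finset V) (d : ℕ) (hd : ∀ v, (nbr v).card ≤ d) (p x : ℝ) (hx0 : 0 ≤ x)
    (hx1 : x < 1) (hpx : p ≤ x * (1 - x) ^ d)
    (hA : ∀ v (S : Finset V), v ∉ S → Disjoint S (nbr v) →
      (((avoiding Ω₀ A S).filter (A v)).card : ℝ) ≤ p * (avoiding Ω₀ A S).card) :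
    ∃ ω ∈ Ω₀, ∀ v, ¬ A v ω := by
  have hpos : ∀ S : Finset V, (0 : ℝ) < (avoiding Ω₀ A S).card := by
    intro S
    induction S using Finset.induction_on with
    | empty => simpa [avoiding] using hΩ
    | insert v S hv ih =>
      rw [card_avoiding_insert]
      have h := card_filter_avoiding_le Ω₀ A nbr d hd p x hx0 hx1.le hpx hA S v hv
      nlinarith
  obtain ⟨ω, hω⟩ := Finset.card_pos.1 (Nat.cast_pos.1 (hpos Finset.univ))
  exact ⟨ω, (mem_avoiding.1 hω).1, fun v => (mem_avoiding.1 hω).2 v (Finset.mem_univ v)⟩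

lemma inv_exp_one_le_one_sub_inv_pow (n : ℕ) :
    (Real.exp 1)⁻¹ ≤ (1 - ((n : ℝ) + 1)⁻¹) ^ n := by
  rcases Nat.eq_zero_or_pos n with rfl | hn
  · simpa using inv_le_one_of_one_le₀ (Real.one_le_exp zero_le_one)
  have hn' : (0 : ℝ) < n := Nat.cast_pos.2 hn
  have h : 1 - ((n : ℝ) + 1)⁻¹ = ((n : ℝ)⁻¹ + 1)⁻¹ := by field_simp; ring
  rw [h, inv_pow]
  refine inv_anti₀ (by positivity) ?_
  calc ((n : ℝ)⁻¹ + 1) ^ n ≤ Real.exp (n : ℝ)⁻¹ ^ n := by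
        gcongr
        exact Real.add_one_le_exp _
    _ = Real.exp 1 := by rw [← Real.exp_nat_mul, mul_inv_cancel₀ hn'.ne']

lemma card_filter_mem_powersetCard_mul_le {α : Type*} [DecidableEq α] (s : Finset α) (l : ℕ)
    (c : α) :
    ((s.powersetCard l).filter (c ∈ ·)).card * s.card ≤ l * (s.powersetCard l).card := by
  by_cases hc : c ∈ s
  swap
  · have h : (s.powersetCard l).filter (c ∈ ·) = ∅ :=
      Finset.filter_eq_empty_iff.2 fun t ht hct => hc ((Finset.mem_powersetCard.1 ht).1 hct)
    simp [h]
  rcases l with _ | l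
  · simp
  have hsub : (s.powersetCard (l + 1)).filter (c ∈ ·) ⊆
      ((s.erase c).powersetCard l).image (insert c) := by
    intro t ht
    obtain ⟨ht, hct⟩ := Finset.mem_filter.1 ht
    obtain ⟨hts, htc⟩ := Finset.mem_powersetCard.1 ht
    refine Finset.mem_image.2 ⟨t.erase c, Finset.mem_powersetCard.2
      ⟨Finset.erase_subset_erase c hts, ?_⟩, Finset.insert_erase hct⟩
    rw [Finset.card_erase_of_mem hct, htc, Nat.add_sub_cancel]
  have hle := (Finset.card_le_card hsub).trans Finset.card_image_le
  have hs := Finset.card_erase_add_one hc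
  rw [Finset.card_powersetCard] at hle ⊢
  have hch := Nat.add_one_mul_choose_eq (s.erase c).card l
  rw [← hs]
  nlinarith

/-- Conditioning on coordinate `u` of a set that does not depend on coordinate `u`. -/
lemma card_filter_apply_mul {V β : Type*} [DecidableEq V] (B : Finset (V → β)) (u : V)
    (P : Finset β) (hP : ∀ ω ∈ B, ω u ∈ P)
    (hB : ∀ ω ∈ B, ∀ s ∈ P, Function.update ω u s ∈ B) (q : β → Prop) [DecidablePred q] :
    (B.filter fun ω => q (ω u)).card * P.card = B.card * (P.filter q).card := by
  rw [← Finset.card_product, ← Finset.card_product]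
  refine Finset.card_bij' (fun z _ => (Function.update z.1 u z.2, z.1 u))
    (fun z _ => (Function.update z.1 u z.2, z.1 u)) ?_ ?_ ?_ ?_
  · rintro ⟨ω, s⟩ h
    simp only [Finset.mem_product, Finset.mem_filter] at h ⊢
    exact ⟨hB ω h.1.1 s h.2, hP ω h.1.1, h.1.2⟩
  · rintro ⟨ω, s⟩ h
    simp only [Finset.mem_product, Finset.mem_filter] at h ⊢
    exact ⟨⟨hB ω h.1 s h.2.1, by simpa using h.2.2⟩, hP ω h.1⟩
  · rintro ⟨ω, s⟩ _
    simp
  · rintro ⟨ω, s⟩ _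
    simp

lemma card_filter_forall_mem_le {V : Type*} [DecidableEq V] (L : V → Finset ℕ) (l m : ℕ)
    (hl : 0 < l) (hlm : l ≤ m) (hL : ∀ v, (L v).card = m) (c : ℕ) (B : Finset (V → Finset ℕ))
    (hP : ∀ ω ∈ B, ∀ u, ω u ∈ (L u).powersetCard l) (T : Finset V)
    (hB : ∀ ω ∈ B, ∀ u ∈ T, ∀ s ∈ (L u).powersetCard l, Function.update ω u s ∈ B) :
    ((B.filter fun ω => ∀ u ∈ T, c ∈ ω u).card : ℝ) ≤ ((l : ℝ) / m) ^ T.card * B.card := by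
  have hm : (0 : ℝ) < m := Nat.cast_pos.2 (hl.trans_le hlm)
  induction T using Finset.induction_on with
  | empty => simp
  | insert u T hu ih =>
    have ih' := ih fun ω hω w hw => hB ω hω w (Finset.mem_insert_of_mem hw)
    set B' := B.filter fun ω => ∀ u ∈ T, c ∈ ω u with hB'
    have hfil : (B.filter fun ω => ∀ w ∈ insert u T, c ∈ ω w) =
        B'.filter fun ω => c ∈ ω u := by
      ext ω
      simp only [hB', Finset.mem_filter, Finset.forall_mem_insert]
      tauto
    have hcount := card_filter_apply_mul B' u ((L u).powersetCard l)
      (fun ω hω => hP ω (Finset.mem_filter.1 hω).1 u)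
      (fun ω hω s hs => Finset.mem_filter.2
        ⟨hB ω (Finset.mem_filter.1 hω).1 u (Finset.mem_insert_self u T) s hs, fun w hw => by
          rw [Function.update_of_ne (ne_of_mem_of_not_mem hw hu)]
          exact (Finset.mem_filter.1 hω).2 w hw⟩) (c ∈ ·)
    have hsingle := card_filter_mem_powersetCard_mul_le (L u) l c
    rw [hL u] at hsingle
    have hPpos : 0 < ((L u).powersetCard l).card :=
      Finset.card_pos.2 (Finset.powersetCard_nonempty.2 (by rw [hL u]; exact hlm))
    have hkey : (B'.filter fun ω => c ∈ ω u).card * m ≤ l * B'.card := by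
      refine Nat.le_of_mul_le_mul_right ?_ hPpos
      calc _ = ((B'.filter fun ω => c ∈ ω u).card * ((L u).powersetCard l).card) * m := by ring
        _ = B'.card * ((((L u).powersetCard l).filter (c ∈ ·)).card * m) := by
          rw [hcount]; ring
        _ ≤ B'.card * (l * ((L u).powersetCard l).card) := by gcongr
        _ = _ := by ring
    have hkey' : ((B'.filter fun ω => c ∈ ω u).card : ℝ) ≤ (l : ℝ) / m * B'.card := by
      rw [div_mul_eq_mul_div, le_div_iff₀ hm]
      exact_mod_cast hkey
    rw [hfil, Finset.card_insert_of_notMem hu, pow_succ', mul_assoc]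
    exact hkey'.trans (by gcongr)

/-- If `G` is a finite `k`-regular graph (`k ≥ 2`), `0 < l ≤ m` with
`e · k² · m · (l/m)^k ≤ 1`, and each vertex `v` has a list `L v` of `m` colors, then one can
choose `l`-element sublists `L' v ⊆ L v` so that for every vertex the sublists of its
neighbors have empty intersection. -/
theorem exists_sublists_empty_neighborhood_intersection
    {V : Type*} [Fintype V] (G : SimpleGraph V) (k : ℕ) (hk : 2 ≤ k)
    (hreg : IsKRegular G k) (l m : ℕ) (hl : 0 < l) (hlm : l ≤ m)
    (hineq : Real.exp 1 * (k : ℝ) ^ 2 * (m : ℝ) * ((l : ℝ) / (m : ℝ)) ^ k ≤ 1)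
    (L : V → Finset ℕ) (hL : ∀ v, (L v).card = m) :
    ∃ L' : V → Finset ℕ, (∀ v, L' v ⊆ L v) ∧ (∀ v, (L' v).card = l) ∧
      ∀ v : V, (⋂ u ∈ G.neighborSet v, ((L' u : Set ℕ))) = ∅ := by
  classical
  have hdeg : ∀ v, (G.neighborFinset v).card = k := fun v => by
    rw [← hreg v, Set.ncard_eq_toFinset_card', SimpleGraph.neighborFinset]
  have hk2 : (1 : ℕ) ≤ k ^ 2 := Nat.one_le_pow _ _ (by omega)
  have hcast : ((k ^ 2 - 1 : ℕ) : ℝ) + 1 = (k : ℝ) ^ 2 := by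
    rw [Nat.cast_sub hk2]; push_cast; ring
  have hkR : (2 : ℝ) ≤ k := by exact_mod_cast hk
  obtain ⟨ω, hω, hgood⟩ : ∃ ω ∈ Fintype.piFinset fun v => (L v).powersetCard l,
      ∀ v, ¬ ∃ c, ∀ u ∈ G.neighborFinset v, c ∈ ω u := by
    refine exists_forall_not_of_local _
      (Fintype.piFinset_nonempty.2 fun v =>
        Finset.powersetCard_nonempty.2 (by rw [hL v]; exact hlm))
      (fun v ω => ∃ c, ∀ u ∈ G.neighborFinset v, c ∈ ω u)
      (fun v => (G.neighborFinset v).biUnion fun u => (G.neighborFinset u).erase v)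
      (k ^ 2 - 1) ?_ (m * ((l : ℝ) / m) ^ k) (((k : ℝ) ^ 2)⁻¹) (by positivity)
      (inv_lt_one_of_one_lt₀ (by nlinarith)) ?_ ?_
    · intro v
      have h : ∀ u ∈ G.neighborFinset v, ((G.neighborFinset u).erase v).card ≤ k - 1 := by
        intro u hu
        rw [Finset.card_erase_of_mem (by simpa [SimpleGraph.adj_comm] using hu), hdeg u]
      refine (Finset.card_biUnion_le_card_mul _ _ _ h).trans ?_
      rw [hdeg v, Nat.mul_sub, mul_one, ← sq]
      omega
    · have h := inv_exp_one_le_one_sub_inv_pow (k ^ 2 - 1)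
      rw [hcast] at h
      refine le_trans ?_ (mul_le_mul_of_nonneg_left h (by positivity))
      rw [← mul_inv, ← one_div, le_div_iff₀ (by positivity)]
      linarith
    · intro v S hv hS
      set B := avoiding (Fintype.piFinset fun v => (L v).powersetCard l)
        (fun v ω => ∃ c, ∀ u ∈ G.neighborFinset v, c ∈ ω u) S
      obtain ⟨u₀, hu₀⟩ : (G.neighborFinset v).Nonempty :=
        Finset.card_pos.1 (by rw [hdeg v]; omega)
      have hP : ∀ ω ∈ B, ∀ u, ω u ∈ (L u).powersetCard l := fun ω hω =>
        Fintype.mem_piFinset.1 (mem_avoiding.1 hω).1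
      have hB : ∀ ω ∈ B, ∀ u ∈ G.neighborFinset v, ∀ s ∈ (L u).powersetCard l,
          Function.update ω u s ∈ B := by
        intro ω hω u hu s hs
        refine mem_avoiding.2 ⟨Fintype.mem_piFinset.2 fun w => ?_, ?_⟩
        · rcases eq_or_ne w u with rfl | hwu
          · simpa using hs
          · rw [Function.update_of_ne hwu]
            exact hP ω hω w
        · rintro w hw ⟨c, hc⟩
          refine (mem_avoiding.1 hω).2 w hw ⟨c, fun y hy => ?_⟩
          have hyu : y ≠ u := by
            rintro rfl
            refine Finset.disjoint_left.1 hS hw (Finset.mem_biUnion.2 ⟨y, hu, ?_⟩)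
            refine Finset.mem_erase.2 ⟨ne_of_mem_of_not_mem hw hv, ?_⟩
            simpa [SimpleGraph.adj_comm] using hy
          simpa [Function.update_of_ne hyu] using hc y hy
      have hsub : (B.filter fun ω => ∃ c, ∀ u ∈ G.neighborFinset v, c ∈ ω u) ⊆
          (L u₀).biUnion fun c => B.filter fun ω => ∀ u ∈ G.neighborFinset v, c ∈ ω u := by
        intro ω hω
        obtain ⟨hωB, c, hc⟩ := Finset.mem_filter.1 hω
        exact Finset.mem_biUnion.2 ⟨c, (Finset.mem_powersetCard.1 (hP ω hωB u₀)).1 (hc u₀ hu₀),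
          Finset.mem_filter.2 ⟨hωB, hc⟩⟩
      calc ((B.filter fun ω => ∃ c, ∀ u ∈ G.neighborFinset v, c ∈ ω u).card : ℝ)
          ≤ ∑ c ∈ L u₀, ((B.filter fun ω => ∀ u ∈ G.neighborFinset v, c ∈ ω u).card : ℝ) := by
            exact_mod_cast (Finset.card_le_card hsub).trans Finset.card_biUnion_le
        _ ≤ ∑ c ∈ L u₀, ((l : ℝ) / m) ^ k * B.card := by
            refine Finset.sum_le_sum fun c _ => ?_
            have h := card_filter_forall_mem_le L l m hl hlm hL c B hP (G.neighborFinset v) hB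
            rw [hdeg v] at h
            refine le_trans (le_of_eq ?_) h
            congr!
        _ = m * ((l : ℝ) / m) ^ k * B.card := by
            rw [Finset.sum_const, hL u₀, nsmul_eq_mul, mul_assoc]
  have hmem v := Finset.mem_powersetCard.1 (Fintype.mem_piFinset.1 hω v)
  refine ⟨ω, fun v => (hmem v).1, fun v => (hmem v).2, fun v => ?_⟩
  refine Set.eq_empty_iff_forall_notMem.2 fun c hc => hgood v ⟨c, fun u hu => ?_⟩
  simpa using Set.mem_iInter₂.1 hc u (by simpa using hu)
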